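/- Let φ : ℝ² → ℝ be smooth and let λ be a nonzero real number. Then the matrix-valued maps A(x,y) := A_φ(x,y,λ) and B(x,y) := B_φ(x,y,λ) satisfy the zero-curvature (compatibility) equation ∂_yA(x,y) − ∂ₓB(x,y) − (A(x,y)·B(x,y) − B(x,y)·A(x,y)) = 0 for all (x,y) ∈ ℝ² if and only if φ satisfies the sine-Gordon equation ∂ₓ∂_yφ(x,y) = sin(φ(x,y)) for all (x,y) ∈ ℝ². -/

import Mathlib

open Matrix Complex

attribute [local instance] Matrix.normedAddCommGroup Matrix.normedSpace

noncomputable section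

/-- The Pauli matrix σ₃. -/
def sigma3 : Matrix (Fin 2) (Fin 2) ℂ := !![1, 0; 0, -1]

/-- The matrix `A_φ(x,y,λ) = (i/2)·[[∂ₓφ, −λ], [−λ, −∂ₓφ]]` of the Lax system. -/
def Aphi (φ : ℝ → ℝ → ℝ) (lam : ℂ) (x y : ℝ) : Matrix (Fin 2) (Fin 2) ℂ :=
  (Complex.I / 2) •
    !![((deriv (fun x' => φ x' y) x : ℝ) : ℂ), -lam;
       -lam, -((deriv (fun x' => φ x' y) x : ℝ) : ℂ)]

/-- The matrix `B_φ(x,y,λ) = (i/2)·λ⁻¹·[[0, e^{−iφ}], [e^{iφ}, 0]]` of the Lax system. -/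
def Bphi (φ : ℝ → ℝ → ℝ) (lam : ℂ) (x y : ℝ) : Matrix (Fin 2) (Fin 2) ℂ :=
  (Complex.I / 2) • lam⁻¹ •
    !![0, Complex.exp (-Complex.I * ((φ x y : ℝ) : ℂ));
       Complex.exp (Complex.I * ((φ x y : ℝ) : ℂ)), 0]

/-- Membership in SU(2): unitary with determinant one. -/
def IsSU2 (g : Matrix (Fin 2) (Fin 2) ℂ) : Prop := g * gᴴ = 1 ∧ g.det = 1

/-- The bilinear pairing `⟨X,Y⟩ = −2·tr(X·Y)` on 2×2 complex matrices. -/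
def pairing (X Y : Matrix (Fin 2) (Fin 2) ℂ) : ℂ := -2 * (X * Y).trace

/-- A matrix-valued map with differentiable entries is differentiable, entrywise. -/
theorem hasDerivAt_matrix_of_entries {m n : Type*} [Fintype m] [Fintype n]
    {M : ℝ → Matrix m n ℂ} {M' : Matrix m n ℂ} {t : ℝ}
    (h : ∀ i j, HasDerivAt (fun s => M s i j) (M' i j) t) : HasDerivAt M M' t :=
  hasDerivAt_pi.2 fun i => hasDerivAt_pi.2 fun j => h i j

section PartialDerivatives

variable {φ : ℝ → ℝ → ℝ}

theorem hasDerivAt_slice_fst {x y : ℝ}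
    (h : DifferentiableAt ℝ (fun p : ℝ × ℝ => φ p.1 p.2) (x, y)) :
    HasDerivAt (fun x' => φ x' y) (fderiv ℝ (fun p : ℝ × ℝ => φ p.1 p.2) (x, y) (1, 0)) x :=
  HasFDerivAt.comp_hasDerivAt (f := fun x' : ℝ => (x', y)) x h.hasFDerivAt
    ((hasDerivAt_id x).prodMk (hasDerivAt_const x y))

theorem hasDerivAt_slice_snd {x y : ℝ}
    (h : DifferentiableAt ℝ (fun p : ℝ × ℝ => φ p.1 p.2) (x, y)) :
    HasDerivAt (fun y' => φ x y') (fderiv ℝ (fun p : ℝ × ℝ => φ p.1 p.2) (x, y) (0, 1)) y :=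
  HasFDerivAt.comp_hasDerivAt (f := fun y' : ℝ => (x, y')) y h.hasFDerivAt
    ((hasDerivAt_const y x).prodMk (hasDerivAt_id y))

/-- Schwarz's theorem for the iterated partial derivatives of a `C²` function on the plane. -/
theorem hasDerivAt_deriv_fst_mixed (hφ : ContDiff ℝ 2 (fun p : ℝ × ℝ => φ p.1 p.2)) (x y : ℝ) :
    HasDerivAt (fun y' => deriv (fun x' => φ x' y') x)
      (deriv (fun x' => deriv (fun y' => φ x' y') y) x) y := by
  have hd : Differentiable ℝ (fun p : ℝ × ℝ => φ p.1 p.2) := hφ.differentiable (by norm_num)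
  have hd2 : Differentiable ℝ (fderiv ℝ (fun p : ℝ × ℝ => φ p.1 p.2)) :=
    (hφ.fderiv_right (m := 1) (by norm_num)).differentiable (by norm_num)
  have hfst (y' : ℝ) := (hasDerivAt_slice_fst (hd (x, y'))).deriv
  have hsnd (x' : ℝ) := (hasDerivAt_slice_snd (hd (x', y))).deriv
  simp only [hfst, hsnd]
  have hv (v : ℝ × ℝ) : HasFDerivAt (fun p => fderiv ℝ (fun p : ℝ × ℝ => φ p.1 p.2) p v)
      ((fderiv ℝ (fderiv ℝ (fun p : ℝ × ℝ => φ p.1 p.2)) (x, y)).flip v) (x, y) := by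
    simpa using (hd2 (x, y)).hasFDerivAt.clm_apply (hasFDerivAt_const v (x, y))
  have hyx := hasDerivAt_slice_snd
    (φ := fun a b => fderiv ℝ (fun p : ℝ × ℝ => φ p.1 p.2) (a, b) (1, 0))
    (hv (1, 0)).differentiableAt
  have hxy := hasDerivAt_slice_fst
    (φ := fun a b => fderiv ℝ (fun p : ℝ × ℝ => φ p.1 p.2) (a, b) (0, 1))
    (hv (0, 1)).differentiableAt
  have hsymm : IsSymmSndFDerivAt ℝ (fun p : ℝ × ℝ => φ p.1 p.2) (x, y) :=
    hφ.contDiffAt.isSymmSndFDerivAt (by simp)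
  rw [hxy.deriv]
  convert hyx using 1
  simp only [Prod.mk.eta, (hv _).fderiv, ContinuousLinearMap.flip_apply]
  exact hsymm _ _

end PartialDerivatives

theorem deriv_Aphi_snd {φ : ℝ → ℝ → ℝ} {x y d : ℝ} (lam : ℂ)
    (h : HasDerivAt (fun y' => deriv (fun x' => φ x' y') x) d y) :
    deriv (fun y' => Aphi φ lam x y') y = (I / 2) • !![(d : ℂ), 0; 0, -(d : ℂ)] := by
  refine (hasDerivAt_matrix_of_entries fun i j => ?_).deriv
  have hc := h.ofReal_comp
  fin_cases i <;> fin_cases j <;> simp only [Aphi, Matrix.smul_apply] <;>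
    refine HasDerivAt.const_smul (I / 2) ?_
  · exact hc
  · exact hasDerivAt_const _ _
  · exact hasDerivAt_const _ _
  · exact hc.neg

theorem deriv_Bphi_fst {φ : ℝ → ℝ → ℝ} {x y p : ℝ} (lam : ℂ)
    (h : HasDerivAt (fun x' => φ x' y) p x) :
    deriv (fun x' => Bphi φ lam x' y) x =
      (I / 2) • lam⁻¹ • !![0, exp (-I * (φ x y : ℂ)) * (-I * (p : ℂ));
        exp (I * (φ x y : ℂ)) * (I * (p : ℂ)), 0] := by
  refine (hasDerivAt_matrix_of_entries fun i j => ?_).deriv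
  have hc := h.ofReal_comp
  fin_cases i <;> fin_cases j <;> simp only [Bphi, Matrix.smul_apply] <;>
    refine HasDerivAt.const_smul (I / 2) (HasDerivAt.const_smul lam⁻¹ ?_)
  · exact hasDerivAt_const _ _
  · exact (hc.const_mul (-I)).cexp
  · exact (hc.const_mul I).cexp
  · exact hasDerivAt_const _ _

/-- The curvature of the Lax pair is a multiple of `σ₃` by the sine-Gordon defect. -/
theorem curvature_eq_smul_sigma3 {φ : ℝ → ℝ → ℝ} {x y p d : ℝ} {lam : ℂ} (hlam : lam ≠ 0)
    (hp : HasDerivAt (fun x' => φ x' y) p x)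
    (hd : HasDerivAt (fun y' => deriv (fun x' => φ x' y') x) d y) :
    deriv (fun y' => Aphi φ lam x y') y - deriv (fun x' => Bphi φ lam x' y) x
        - (Aphi φ lam x y * Bphi φ lam x y - Bphi φ lam x y * Aphi φ lam x y) =
      (I / 2 * ((d - Real.sin (φ x y) : ℝ) : ℂ)) • sigma3 := by
  have hsin : ((Real.sin (φ x y) : ℝ) : ℂ) =
      (exp (-I * (φ x y : ℂ)) - exp (I * (φ x y : ℂ))) * I / 2 := by
    simp only [ofReal_sin, Complex.sin, neg_mul, mul_comm I]
  rw [deriv_Aphi_snd lam hd, deriv_Bphi_fst lam hp, Complex.ofReal_sub, hsin, Aphi, Bphi, hp.deriv]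
  have hI : I ^ 2 = -1 := I_sq
  ext i j
  fin_cases i <;> fin_cases j <;> simp [sigma3] <;>
    field_simp <;> grind

/-- The zero-curvature (compatibility) equation `A_y − B_x − [A,B] = 0` for the Lax pair
`A = A_φ(·,·,λ)`, `B = B_φ(·,·,λ)` holds at every point of `ℝ²` if and only if `φ`
satisfies the sine-Gordon equation `∂ₓ∂_yφ = sin φ` everywhere. -/
theorem zero_curvature_iff_sineGordon
    (φ : ℝ → ℝ → ℝ) (hφ : ContDiff ℝ (⊤ : ℕ∞) (fun p : ℝ × ℝ => φ p.1 p.2))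
    (lam : ℝ) (hlam : lam ≠ 0) :
    (∀ x y : ℝ,
        deriv (fun y' => Aphi φ (lam : ℂ) x y') y
          - deriv (fun x' => Bphi φ (lam : ℂ) x' y) x
          - (Aphi φ (lam : ℂ) x y * Bphi φ (lam : ℂ) x y
              - Bphi φ (lam : ℂ) x y * Aphi φ (lam : ℂ) x y) = 0) ↔
    (∀ x y : ℝ, deriv (fun x' => deriv (fun y' => φ x' y') y) x = Real.sin (φ x y)) := by
  have hlam' : (lam : ℂ) ≠ 0 := ofReal_ne_zero.2 hlam
  have hφ2 : ContDiff ℝ 2 (fun p : ℝ × ℝ => φ p.1 p.2) := contDiff_infty.1 hφ 2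
  have hsigma : sigma3 ≠ 0 := fun h => by simpa [sigma3] using congrFun (congrFun h 0) 0
  refine forall₂_congr fun x y => ?_
  rw [curvature_eq_smul_sigma3 hlam'
    (hasDerivAt_slice_fst (hφ2.differentiable (by norm_num) (x, y)))
    (hasDerivAt_deriv_fst_mixed hφ2 x y), smul_eq_zero_iff_left hsigma]
  simp [sub_eq_zero, -ofReal_sub, -ofReal_sin]

end
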